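/- The vector space kLT(𝔖) spanned by ordered rooted trees with non-root nodes labeled by elements of a set 𝔖, equipped with the tree-attachment product and the coproduct Δ(T) = Σ_𝒳 T_𝒳 ⊗ T_{ℱ∖𝒳} (sum over sub-multisets 𝒳 of the multiset ℱ of root-subtrees of T), is a cocommutative graded connected Hopf algebra, graded by number of non-root nodes. -/

import Mathlib

/-- An ordered labeled subtree: a node with a label and an ordered list of children. -/
inductive LSub (D : Type) : Type
  | mk : D → List (LSub D) → LSub D

/-- An ordered rooted tree with unlabeled root and non-root nodes labeled in `D`,
represented by the list of subtrees attached to the root. -/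
abbrev LTree (D : Type) := List (LSub D)

mutual
  /-- Number of nodes of a labeled subtree. -/
  def sizeS {D : Type} : LSub D → Nat
    | .mk _ ts => 1 + sizeL ts
  /-- Total number of (labeled) nodes of a forest. -/
  def sizeL {D : Type} : List (LSub D) → Nat
    | [] => 0
    | t :: ts => sizeS t + sizeL ts
end

mutual
  /-- Graft pending subtrees (given by `f`, indexed by the preorder index of nodes)
  onto a subtree whose own preorder index is `i`; attached subtrees are prepended. -/
  def graftS {D : Type} (f : Nat → List (LSub D)) (i : Nat) : LSub D → LSub D
    | .mk d ts => .mk d (f i ++ graftL f (i + 1) ts)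
  def graftL {D : Type} (f : Nat → List (LSub D)) (i : Nat) : List (LSub D) → List (LSub D)
    | [] => []
    | t :: ts => graftS f i t :: graftL f (i + sizeS t) ts
end

/-- Graft pending subtrees onto a tree; the root has preorder index `0`. -/
def graft {D : Type} (f : Nat → List (LSub D)) (t : LTree D) : LTree D :=
  f 0 ++ graftL f 1 t

/-- All lists of length `m` with entries `< n` (choices of attachment nodes). -/
def choices : Nat → Nat → List (List Nat)
  | 0, _ => [[]]
  | m + 1, n => (List.range n).flatMap fun c => (choices m n).map (c :: ·)

/-- The Grossman–Larson product of two basis trees, as an element of the free module: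
the sum over all ways of attaching the root-subtrees of `T1` to nodes of `T2`. -/
noncomputable def mulT (k : Type) [Semiring k] {D : Type} (T1 T2 : LTree D) :
    LTree D →₀ k :=
  ((choices T1.length (1 + sizeL T2)).map fun c =>
    Finsupp.single
      (graft (fun i => (T1.zip c).filterMap fun p => if p.2 = i then some p.1 else none) T2)
      (1 : k)).sum

/-- `v E`: the two-node tree whose single non-root node is labeled `E`. -/
def vT {D : Type} (E : D) : LTree D := [.mk E []]

/-- `u(E; T₁,…,T_k)`: root has one child labeled `E`, with which the roots of the `Tᵢ`
are identified. -/
def uT {D : Type} (E : D) (Ts : List (LTree D)) : LTree D := [.mk E Ts.flatten]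

/-- `t(T₁,…,T_k)`: identify the roots of the `Tᵢ`. -/
def tT {D : Type} (Ts : List (LTree D)) : LTree D := Ts.flatten

/-- All decompositions of an ordered multiset into a sub-multiset and its complement
(used for the coproduct). -/
def splits {α : Type} : List α → List (List α × List α)
  | [] => [([], [])]
  | a :: l => ((splits l).map fun p => (a :: p.1, p.2)) ++ ((splits l).map fun p => (p.1, a :: p.2))

/-- The labeled node of `T` at position `(i, p)`: the `i`-th root-subtree, then follow
the path `p` of child indices. -/
def subAtL {D : Type} : List (LSub D) → Nat → List Nat → Option (LSub D)
  | [], _, _ => none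
  | t :: _, 0, [] => some t
  | .mk _ cs :: _, 0, j :: p => subAtL cs j p
  | _ :: ts, i + 1, p => subAtL ts i p

/-- Replace the node of `T` at position `(i, p)`: relabel it with `G` and replace the
subtree rooted there (its list of children) by `T'`. -/
def replaceAtL {D : Type} (G : D) (T' : List (LSub D)) :
    List (LSub D) → Nat → List Nat → List (LSub D)
  | [], _, _ => []
  | _ :: ts, 0, [] => .mk G T' :: ts
  | .mk d cs :: ts, 0, j :: p => .mk d (replaceAtL G T' cs j p) :: ts
  | t :: ts, i + 1, p => t :: replaceAtL G T' ts i p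

open TensorProduct in
/-- A cocommutative graded connected Hopf algebra structure on `kLT(𝔖) = LTree D →₀ k`,
whose product is the tree-attachment product `mulT` and whose coproduct is
`Δ(T) = Σ_𝒳 T_𝒳 ⊗ T_{ℱ∖𝒳}` (sum over sub-multisets of the root-subtrees `ℱ`),
graded by the number of non-root nodes. -/
structure TreeHopfStructure (k D : Type) [Field k] where
  mul : (LTree D →₀ k) →ₗ[k] (LTree D →₀ k) →ₗ[k] (LTree D →₀ k)
  comul : (LTree D →₀ k) →ₗ[k] (LTree D →₀ k) ⊗[k] (LTree D →₀ k)
  counit : (LTree D →₀ k) →ₗ[k] k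
  antipode : (LTree D →₀ k) →ₗ[k] (LTree D →₀ k)
  /-- the product of basis trees is the tree-attachment product -/
  mul_basis : ∀ T1 T2 : LTree D,
    mul (Finsupp.single T1 1) (Finsupp.single T2 1) = mulT k T1 T2
  /-- the coproduct of a basis tree is `Σ_𝒳 T_𝒳 ⊗ T_{ℱ∖𝒳}` -/
  comul_basis : ∀ T : LTree D,
    comul (Finsupp.single T 1) =
      ∑ i : Fin (splits T).length,
        (Finsupp.single ((splits T).get i).1 (1 : k)) ⊗ₜ[k]
          (Finsupp.single ((splits T).get i).2 (1 : k))
  /-- the counit sends the one-node tree to `1` and all other trees to `0` -/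
  counit_basis : ∀ T : LTree D,
    counit (Finsupp.single T 1) = if T.isEmpty then 1 else 0
  /-- associativity -/
  mul_assoc' : ∀ x y z, mul (mul x y) z = mul x (mul y z)
  /-- the one-node tree is a two-sided unit -/
  one_mul' : ∀ x, mul (Finsupp.single ([] : LTree D) 1) x = x
  mul_one' : ∀ x, mul x (Finsupp.single ([] : LTree D) 1) = x
  /-- coassociativity -/
  coassoc : ∀ x, (TensorProduct.assoc k _ _ _)
      ((LinearMap.rTensor _ comul) (comul x)) = (LinearMap.lTensor _ comul) (comul x)
  /-- counit laws -/
  counit_comul_left : ∀ x,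
    (TensorProduct.lid k _) ((LinearMap.rTensor _ counit) (comul x)) = x
  counit_comul_right : ∀ x,
    (TensorProduct.rid k _) ((LinearMap.lTensor _ counit) (comul x)) = x
  /-- the coproduct is an algebra map (bialgebra axiom), on basis elements -/
  comul_mul : ∀ T1 T2 : LTree D,
    comul (mul (Finsupp.single T1 1) (Finsupp.single T2 1)) =
      ∑ i : Fin (splits T1).length, ∑ j : Fin (splits T2).length,
        (mul (Finsupp.single ((splits T1).get i).1 1) (Finsupp.single ((splits T2).get j).1 1))
          ⊗ₜ[k]
        (mul (Finsupp.single ((splits T1).get i).2 1) (Finsupp.single ((splits T2).get j).2 1))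
  /-- the counit is an algebra map -/
  counit_mul : ∀ x y, counit (mul x y) = counit x * counit y
  counit_one : counit (Finsupp.single ([] : LTree D) 1) = 1
  /-- cocommutativity -/
  cocomm : ∀ x, (TensorProduct.comm k _ _) (comul x) = comul x
  /-- antipode axioms -/
  antipode_left : ∀ x, (TensorProduct.lift mul) ((LinearMap.rTensor _ antipode) (comul x)) =
    counit x • Finsupp.single ([] : LTree D) 1
  antipode_right : ∀ x, (TensorProduct.lift mul) ((LinearMap.lTensor _ antipode) (comul x)) =
    counit x • Finsupp.single ([] : LTree D) 1
  /-- the product respects the grading by number of non-root nodes -/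
  mul_graded : ∀ T1 T2 T : LTree D, (mulT k T1 T2) T ≠ 0 → sizeL T = sizeL T1 + sizeL T2
  /-- the coproduct respects the grading -/
  comul_graded : ∀ (T : LTree D) (p : List (LSub D) × List (LSub D)),
    p ∈ splits T → sizeL p.1 + sizeL p.2 = sizeL T
  /-- connectedness: the degree-0 component is spanned by the one-node tree -/
  connected : ∀ T : LTree D, sizeL T = 0 → T = ([] : LTree D)


namespace TreeAux

open Multiset

theorem bcongr {α β : Type} {s : Multiset α} {f g : α → Multiset β} (h : ∀ a, f a = g a) :
    s.bind f = s.bind g := by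
  rw [funext h]

/-- Multiset of splits. -/
def spl {α : Type} (T : List α) : Multiset (List α × List α) := (splits T : Multiset _)

theorem spl_nil {α : Type} : spl ([] : List α) = {([], [])} := rfl

theorem spl_cons {α : Type} (a : α) (l : List α) :
    spl (a :: l) = (spl l).map (fun p => (a :: p.1, p.2)) + (spl l).map (fun p => (p.1, a :: p.2)) := by
  simp [spl, splits]

theorem spl_nil_bind {α β : Type} (F : List α × List α → Multiset β) :
    (spl ([] : List α)).bind F = F ([], []) := by
  simp [spl_nil]

theorem spl_cons_bind {α β : Type} (a : α) (l : List α) (F : List α × List α → Multiset β) :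
    (spl (a :: l)).bind F =
      (spl l).bind (fun p => F (a :: p.1, p.2)) + (spl l).bind (fun p => F (p.1, a :: p.2)) := by
  rw [spl_cons, add_bind, bind_map, bind_map]

theorem spl_coassoc {α β : Type} (x : List α) (F : List α → List α → List α → Multiset β) :
    (spl x).bind (fun p => (spl p.1).bind fun q => F q.1 q.2 p.2) =
      (spl x).bind (fun p => (spl p.2).bind fun q => F p.1 q.1 q.2) := by
  induction x generalizing F with
  | nil => simp [spl_nil]
  | cons a l ih =>
    simp only [spl_cons_bind, bind_add]
    rw [ih (fun u v w => F (a :: u) v w), ih (fun u v w => F u (a :: v) w),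
      ih (fun u v w => F u v (a :: w))]
    abel

theorem spl_cocomm {α β : Type} (x : List α) (F : List α → List α → Multiset β) :
    (spl x).bind (fun p => F p.1 p.2) = (spl x).bind (fun p => F p.2 p.1) := by
  induction x generalizing F with
  | nil => simp [spl_nil]
  | cons a l ih =>
    simp only [spl_cons_bind]
    rw [ih (fun u v => F (a :: u) v), ih (fun u v => F u (a :: v))]
    abel

theorem spl_interchange {α β : Type} (x : List α)
    (F : List α → List α → List α → List α → Multiset β) :
    (spl x).bind (fun p => (spl p.1).bind fun q => (spl p.2).bind fun r => F q.1 q.2 r.1 r.2) =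
    (spl x).bind (fun p => (spl p.1).bind fun q => (spl p.2).bind fun r => F q.1 r.1 q.2 r.2) := by
  induction x generalizing F with
  | nil => simp [spl_nil]
  | cons a l ih =>
    simp only [spl_cons_bind, bind_add]
    rw [ih (fun u v w t => F (a :: u) v w t), ih (fun u v w t => F u (a :: v) w t),
      ih (fun u v w t => F u v (a :: w) t), ih (fun u v w t => F u v w (a :: t))]
    abel

/-- a commuted coassociativity -/
theorem spl_left_comm {α β : Type} (x : List α) (F : List α → List α → List α → Multiset β) :
    (spl x).bind (fun p => (spl p.2).bind fun q => F p.1 q.1 q.2) =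
      (spl x).bind (fun p => (spl p.2).bind fun q => F q.1 p.1 q.2) := by
  rw [← spl_coassoc, ← spl_coassoc x (fun u v w => F v u w)]
  refine bcongr fun p => ?_
  exact spl_cocomm p.1 (fun u v => F u v p.2)

theorem spl_append {α β : Type} (x y : List α) (F : List α → List α → Multiset β) :
    (spl (x ++ y)).bind (fun p => F p.1 p.2) =
      (spl x).bind fun p => (spl y).bind fun q => F (p.1 ++ q.1) (p.2 ++ q.2) := by
  induction x generalizing F with
  | nil => simp [spl_nil]
  | cons a l ih =>
    simp only [List.cons_append, spl_cons_bind]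
    rw [ih (fun u v => F (a :: u) v), ih (fun u v => F u (a :: v))]

mutual
  /-- Attach all of `x` to nodes of the subtree. -/
  def phiS {D : Type} : LSub D → List (LSub D) → Multiset (LSub D)
    | .mk d cs => fun x => (spl x).bind fun p => (phiL cs p.2).bind fun U => {LSub.mk d (p.1 ++ U)}
  /-- Attach all of `x` to non-root nodes of the tree. -/
  def phiL {D : Type} : List (LSub D) → List (LSub D) → Multiset (List (LSub D))
    | [] => fun x => match x with
      | [] => {[]}
      | _ :: _ => 0
    | t :: ts => fun x => (spl x).bind fun p => (phiS t p.1).bind fun u =>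
        (phiL ts p.2).bind fun V => {u :: V}
end

/-- The product as a multiset of trees. -/
def mu {D : Type} (x T : List (LSub D)) : Multiset (List (LSub D)) :=
  (spl x).bind fun p => (phiL T p.2).bind fun U => {p.1 ++ U}

variable {D : Type}

theorem phiS_mk (d : D) (cs x : List (LSub D)) :
    phiS (.mk d cs) x = (mu x cs).bind fun U => {LSub.mk d U} := by
  simp [phiS, mu, bind_assoc]

theorem phiL_nil_nil : phiL ([] : List (LSub D)) [] = {[]} := by simp [phiL]
theorem phiL_nil_cons (a : LSub D) (l) : phiL ([] : List (LSub D)) (a :: l) = 0 := by simp [phiL]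
theorem phiL_cons (t : LSub D) (ts x) : phiL (t :: ts) x = (spl x).bind fun p =>
    (phiS t p.1).bind fun u => (phiL ts p.2).bind fun V => {u :: V} := by simp [phiL]

theorem mu_bind {β : Type} (x T : List (LSub D)) (F : List (LSub D) → Multiset β) :
    (mu x T).bind F = (spl x).bind fun p => (phiL T p.2).bind fun U => F (p.1 ++ U) := by
  simp [mu, bind_assoc, bind_map]

theorem phiL_cons_bind {β : Type} (t : LSub D) (ts x) (F : List (LSub D) → Multiset β) :
    (phiL (t :: ts) x).bind F = (spl x).bind fun p =>
    (phiS t p.1).bind fun u => (phiL ts p.2).bind fun V => F (u :: V) := by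
  simp [phiL_cons, bind_assoc, bind_map]

theorem phiS_bind {β : Type} (d : D) (cs x) (F : LSub D → Multiset β) :
    (phiS (.mk d cs) x).bind F = (mu x cs).bind fun U => F (LSub.mk d U) := by
  simp [phiS_mk, bind_map]

theorem counit_left {β : Type} (x : List (LSub D))
    (F : List (LSub D) → List (LSub D) → Multiset β) :
    ((spl x).bind fun p => (phiL [] p.1).bind fun U => F U p.2) = F [] x := by
  induction x generalizing F with
  | nil => simp [spl_nil, phiL_nil_nil]
  | cons a l ih =>
    simp only [spl_cons_bind, phiL_nil_cons]
    rw [ih fun u v => F u (a :: v)]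
    simp

theorem counit_right {β : Type} (x : List (LSub D))
    (F : List (LSub D) → List (LSub D) → Multiset β) :
    ((spl x).bind fun p => (phiL [] p.2).bind fun U => F p.1 U) = F x [] := by
  rw [spl_cocomm x fun u v => (phiL [] v).bind fun U => F u U]
  exact counit_left x fun u v => F v u

theorem mu_nil_right (x : List (LSub D)) : mu x [] = {x} := by
  rw [mu, counit_right x fun u v => {u ++ v}]
  simp

mutual
theorem phiS_nil : ∀ t : LSub D, phiS t [] = {t}
  | .mk d cs => by simp [phiS, spl_nil, phiL_nil cs]
theorem phiL_nil : ∀ T : List (LSub D), phiL T [] = {T}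
  | [] => by simp [phiL]
  | t :: ts => by simp [phiL, spl_nil, phiL_nil ts, phiS_nil t]
end

theorem mu_nil_left (x : List (LSub D)) : mu [] x = {x} := by
  simp [mu, spl_nil, phiL_nil]

/-- `phi` is a coalgebra map. -/
theorem phiL_spl {β : Type} (T x : List (LSub D)) (F : List (LSub D) → List (LSub D) → Multiset β) :
    ((phiL T x).bind fun U => (spl U).bind fun p => F p.1 p.2) =
    (spl x).bind fun p => (spl T).bind fun q => (phiL q.1 p.1).bind fun U =>
      (phiL q.2 p.2).bind fun V => F U V := by
  induction T generalizing x F with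
  | nil =>
    simp only [spl_nil_bind]
    rw [counit_left x fun u v => (phiL [] v).bind fun V => F u V]
    cases x with
    | nil => simp [phiL_nil_nil, spl_nil]
    | cons a l => simp [phiL_nil_cons]
  | cons t ts ih =>
    simp only [phiL_cons_bind, spl_cons_bind, bind_add]
    congr 1
    · have : ∀ p u, ((phiL ts p).bind fun V => (spl V).bind fun q => F (u :: q.1) q.2) = _ :=
        fun p u => ih p (fun a b => F (u :: a) b)
      simp only [this]
      have h2 : ∀ p : List (LSub D) × List (LSub D), ((phiS t p.1).bind fun u => (spl p.2).bind fun r =>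
          (spl ts).bind fun q => (phiL q.1 r.1).bind fun U => (phiL q.2 r.2).bind fun V =>
            F (u :: U) V) = (spl p.2).bind fun r => (spl ts).bind fun q => (phiS t p.1).bind fun u =>
            (phiL q.1 r.1).bind fun U => (phiL q.2 r.2).bind fun V =>
            F (u :: U) V := by
        intro p
        rw [bind_bind]
        refine bcongr fun r => ?_
        rw [bind_bind]
      simp only [h2]
      rw [← spl_coassoc x fun a b c => (spl ts).bind fun q => (phiS t a).bind fun u =>
            (phiL q.1 b).bind fun U => (phiL q.2 c).bind fun V => F (u :: U) V]
      refine bcongr fun p => ?_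
      rw [bind_bind]
    · have : ∀ p u, ((phiL ts p).bind fun V => (spl V).bind fun q => F q.1 (u :: q.2)) = _ :=
        fun p u => ih p (fun a b => F a (u :: b))
      simp only [this]
      have h2 : ∀ p : List (LSub D) × List (LSub D), ((phiS t p.1).bind fun u => (spl p.2).bind fun r =>
          (spl ts).bind fun q => (phiL q.1 r.1).bind fun U => (phiL q.2 r.2).bind fun V =>
            F U (u :: V)) = (spl p.2).bind fun r => (spl ts).bind fun q => (phiL q.1 r.1).bind fun U =>
            (phiS t p.1).bind fun u => (phiL q.2 r.2).bind fun V =>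
            F U (u :: V) := by
        intro p
        rw [bind_bind]
        refine bcongr fun r => ?_
        rw [bind_bind]
        refine bcongr fun r => ?_
        rw [bind_bind]
      simp only [h2]
      rw [spl_left_comm x fun a b c => (spl ts).bind fun q => (phiL q.1 b).bind fun U =>
            (phiS t a).bind fun u => (phiL q.2 c).bind fun V => F U (u :: V)]
      refine bcongr fun p => ?_
      rw [bind_bind]
      refine bcongr fun r => ?_
      rw [bind_bind]

/-- `mu` is a coalgebra map. -/
theorem mu_spl {β : Type} (x T : List (LSub D)) (F : List (LSub D) → List (LSub D) → Multiset β) :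
    ((mu x T).bind fun U => (spl U).bind fun p => F p.1 p.2) =
    (spl x).bind fun p => (spl T).bind fun q => (mu p.1 q.1).bind fun U =>
      (mu p.2 q.2).bind fun V => F U V := by
  simp only [mu_bind]
  have h1 : ∀ (a U : List (LSub D)), ((spl (a ++ U)).bind fun p => F p.1 p.2) = _ :=
    fun a U => spl_append a U F
  simp only [h1]
  have h2 : ∀ p : List (LSub D) × List (LSub D),
      ((phiL T p.2).bind fun U => (spl p.1).bind fun r => (spl U).bind fun s =>
        F (r.1 ++ s.1) (r.2 ++ s.2)) = (spl p.1).bind fun r => (spl p.2).bind fun s =>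
        (spl T).bind fun q => (phiL q.1 s.1).bind fun U =>
      (phiL q.2 s.2).bind fun V => F (r.1 ++ U) (r.2 ++ V) := by
    intro p
    rw [bind_bind]
    refine bcongr fun r => ?_
    exact phiL_spl T p.2 fun u v => F (r.1 ++ u) (r.2 ++ v)
  simp only [h2]
  rw [spl_interchange x fun a b c d => (spl T).bind fun q => (phiL q.1 c).bind fun U =>
      (phiL q.2 d).bind fun V => F (a ++ U) (b ++ V)]
  refine bcongr fun p => ?_
  conv_rhs => rw [bind_bind]
  refine bcongr fun r => ?_
  rw [bind_bind]
  refine bcongr fun q => ?_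
  rw [bind_bind]

theorem phiL_append {β : Type} (S T x : List (LSub D)) (F : List (LSub D) → Multiset β) :
    (phiL (S ++ T) x).bind F = (spl x).bind fun p => (phiL S p.1).bind fun U =>
      (phiL T p.2).bind fun V => F (U ++ V) := by
  induction S generalizing x F with
  | nil =>
    rw [counit_left x fun u v => (phiL T v).bind fun V => F (u ++ V)]
    simp
  | cons t ts ih =>
    simp only [List.cons_append, phiL_cons_bind]
    have h : ∀ p u, ((phiL (ts ++ T) p).bind fun V => F (u :: V)) = _ :=
      fun p u => ih p fun V => F (u :: V)
    simp only [h]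
    have h2 : ∀ p : List (LSub D) × List (LSub D), ((phiS t p.1).bind fun u => (spl p.2).bind fun q =>
      (phiL ts q.1).bind fun U => (phiL T q.2).bind fun V => F (u :: (U ++ V))) = 
        (spl p.2).bind fun q => (phiS t p.1).bind fun u =>
      (phiL ts q.1).bind fun U => (phiL T q.2).bind fun V => F (u :: (U ++ V)) := by
      intro p
      rw [bind_bind]
    simp only [h2]
    exact (spl_coassoc x fun a b c => (phiS t a).bind fun u =>
      (phiL ts b).bind fun U => (phiL T c).bind fun V => F (u :: (U ++ V))).symm

theorem mu_assoc_of (T : List (LSub D))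
    (hT : ∀ (x y : List (LSub D)) (β : Type) (F : List (LSub D) → Multiset β),
      ((phiL T y).bind fun U => (phiL U x).bind F) = (mu x y).bind fun W => (phiL T W).bind F)
    (x y : List (LSub D)) (β : Type) (F : List (LSub D) → Multiset β) :
    ((mu y T).bind fun U => (mu x U).bind F) = (mu x y).bind fun W => (mu W T).bind F := by
  have h1 : ((mu x y).bind fun W => (mu W T).bind F) = _ :=
    (bcongr fun W => mu_bind W T F).trans
      (mu_spl x y fun a b => (phiL T b).bind fun U => F (a ++ U))
  rw [h1]
  have h2 : ∀ (x y A : List (LSub D)), ((mu x y).bind fun V => (phiL T V).bind fun U => F (A ++ U)) = _ :=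
    fun x y A => (hT x y β fun U => F (A ++ U)).symm
  simp only [h2]
  simp only [mu_bind]
  have h3 : ∀ (q V w r : List (LSub D)), ((phiL (q ++ V) w).bind fun N => F (r ++ N)) = _ :=
    fun q V w r => phiL_append q V w fun N => F (r ++ N)
  simp only [h3]
  have h4 : ∀ q : List (LSub D) × List (LSub D), ((phiL T q.2).bind fun V => (spl x).bind fun p =>
      (spl p.2).bind fun s => (phiL q.1 s.1).bind fun C => (phiL V s.2).bind fun U =>
        F (p.1 ++ (C ++ U))) = (spl x).bind fun p =>
      (spl p.2).bind fun s => (phiL q.1 s.1).bind fun C => (phiL T q.2).bind fun V =>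
        (phiL V s.2).bind fun U =>
        F (p.1 ++ (C ++ U)) := by
    intro q
    rw [bind_bind]
    refine bcongr fun p => ?_
    rw [bind_bind]
    refine bcongr fun p => ?_
    rw [bind_bind]
  simp only [h4]
  rw [bind_bind]
  have h5 : ∀ p : List (LSub D) × List (LSub D), ((spl y).bind fun q => (spl p.2).bind fun s =>
      (phiL q.1 s.1).bind fun C => (phiL T q.2).bind fun V => (phiL V s.2).bind fun U =>
        F (p.1 ++ (C ++ U))) = (spl p.2).bind fun s => (spl y).bind fun q =>
      (phiL q.1 s.1).bind fun C => (phiL T q.2).bind fun V => (phiL V s.2).bind fun U =>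
        F (p.1 ++ (C ++ U)) := by
    intro p
    rw [bind_bind]
  simp only [h5]
  rw [← spl_coassoc x fun a b c => (spl y).bind fun q =>
      (phiL q.1 b).bind fun C => (phiL T q.2).bind fun V => (phiL V c).bind fun U =>
        F (a ++ (C ++ U))]
  refine bcongr fun p => ?_
  rw [bind_bind]
  simp only [List.append_assoc]

theorem phiL_mu_cons (t : LSub D) (T : List (LSub D))
    (ht : ∀ (x y : List (LSub D)) (β : Type) (F : LSub D → Multiset β),
      ((phiS t y).bind fun U => (phiS U x).bind F) = (mu x y).bind fun W => (phiS t W).bind F)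
    (hT : ∀ (x y : List (LSub D)) (β : Type) (F : List (LSub D) → Multiset β),
      ((phiL T y).bind fun U => (phiL U x).bind F) = (mu x y).bind fun W => (phiL T W).bind F)
    (x y : List (LSub D)) (β : Type) (F : List (LSub D) → Multiset β) :
    ((phiL (t :: T) y).bind fun U => (phiL U x).bind F) =
      (mu x y).bind fun W => (phiL (t :: T) W).bind F := by
  simp only [phiL_cons_bind]
  rw [mu_spl x y fun a b => (phiS t a).bind fun u => (phiL T b).bind fun V => F (u :: V)]
  rw [bind_bind]
  refine bcongr fun q => ?_
  have h1 : ∀ u : LSub D, ((phiL T q.2).bind fun V => (spl x).bind fun p =>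
      (phiS u p.1).bind fun u' => (phiL V p.2).bind fun V' => F (u' :: V')) =
      (spl x).bind fun p => (phiS u p.1).bind fun u' => (phiL T q.2).bind fun V =>
        (phiL V p.2).bind fun V' => F (u' :: V') := by
    intro u
    rw [bind_bind]
    refine bcongr fun p => ?_
    rw [bind_bind]
  simp only [h1]
  rw [bind_bind]
  refine bcongr fun p => ?_
  rw [ht p.1 q.1 β fun u' => (phiL T q.2).bind fun V =>
        (phiL V p.2).bind fun V' => F (u' :: V')]
  refine bcongr fun A => ?_
  rw [bind_bind (mu p.2 q.2)]
  refine bcongr fun u => ?_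
  exact hT p.2 q.2 β fun V' => F (u :: V')

mutual
theorem phiS_mu : ∀ (t : LSub D) (x y : List (LSub D)) (β : Type) (F : LSub D → Multiset β),
      ((phiS t y).bind fun U => (phiS U x).bind F) = (mu x y).bind fun W => (phiS t W).bind F
  | .mk d cs, x, y, β, F => by
    simp only [phiS_bind]
    exact mu_assoc_of cs (phiL_mu cs) x y β fun U => F (.mk d U)
theorem phiL_mu : ∀ (T : List (LSub D)) (x y : List (LSub D)) (β : Type)
      (F : List (LSub D) → Multiset β),
      ((phiL T y).bind fun U => (phiL U x).bind F) = (mu x y).bind fun W => (phiL T W).bind F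
  | [], x, y, β, F => by
    rw [mu_bind]
    cases y with
    | nil => simp [phiL_nil_nil, counit_right x fun a b => (phiL [] (a ++ b)).bind F]
    | cons b l =>
      simp only [phiL_nil_cons]
      rw [zero_bind]
      symm
      rw [eq_zero_iff_forall_notMem]
      intro a ha
      simp only [mem_bind] at ha
      obtain ⟨p, -, U, hU, c, hc, -⟩ := ha
      have : U ≠ [] := by
        rintro rfl
        cases b
        simp [phiL_cons] at hU
      cases h : p.1 ++ U with
      | nil => simp_all
      | cons a l => simp [h, phiL_nil_cons] at hc
  | t :: ts, x, y, β, F => phiL_mu_cons t ts (phiS_mu t) (phiL_mu ts) x y β F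
end

theorem mu_assoc (x y T : List (LSub D)) :
    ((mu y T).bind fun U => mu x U) = (mu x y).bind fun W => mu W T := by
  have := mu_assoc_of T (phiL_mu T) x y _ fun U => {U}
  have h : ∀ s : Multiset (List (LSub D)), (s.bind fun U => {U}) = s := by
    intro s; rw [bind_singleton]; simp
  simpa only [h] using this

theorem sizeL_append : ∀ (x y : List (LSub D)), sizeL (x ++ y) = sizeL x + sizeL y
  | [], y => by simp [sizeL]
  | a :: x, y => by simp [sizeL, sizeL_append x y]; omega

theorem spl_size (T : List (LSub D)) : ∀ p ∈ spl T, sizeL p.1 + sizeL p.2 = sizeL T := by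
  induction T with
  | nil => simp [spl_nil, sizeL]
  | cons a l ih =>
    intro p hp
    simp only [spl_cons, mem_add, mem_map] at hp
    rcases hp with ⟨q, hq, rfl⟩ | ⟨q, hq, rfl⟩ <;> have := ih q hq <;> simp [sizeL] <;> omega

theorem spl_length {α : Type} (T : List α) : ∀ p ∈ spl T, p.1.length + p.2.length = T.length := by
  induction T with
  | nil => simp [spl_nil]
  | cons a l ih =>
    intro p hp
    simp only [spl_cons, mem_add, mem_map] at hp
    rcases hp with ⟨q, hq, rfl⟩ | ⟨q, hq, rfl⟩ <;> have := ih q hq <;> simp <;> omega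

mutual
theorem phiS_size : ∀ (t : LSub D) (x : List (LSub D)), ∀ u ∈ phiS t x,
    sizeS u = sizeL x + sizeS t
  | .mk d cs, x, u, hu => by
    simp only [phiS, mem_bind, mem_singleton] at hu
    obtain ⟨p, hp, U, hU, rfl⟩ := hu
    have h1 := phiL_size cs _ U hU
    have h2 := spl_size _ p hp
    simp [sizeS, sizeL_append]; omega
theorem phiL_size : ∀ (t : List (LSub D)) (x : List (LSub D)), ∀ u ∈ phiL t x,
    sizeL u = sizeL x + sizeL t
  | [], [], u, hu => by simp [phiL] at hu; simp [hu, sizeL]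
  | [], _ :: _, u, hu => by simp [phiL] at hu
  | t :: ts, x, u, hu => by
    simp only [phiL, mem_bind, mem_singleton] at hu
    obtain ⟨p, hp, U, hU, V, hV, rfl⟩ := hu
    have h1 := phiS_size t _ U hU
    have h3 := phiL_size ts _ V hV
    have h2 := spl_size _ p hp
    simp [sizeL]; omega
end

theorem mu_size (x T u : List (LSub D)) (hu : u ∈ mu x T) : sizeL u = sizeL x + sizeL T := by
  simp only [mu, mem_bind, mem_singleton] at hu
  obtain ⟨p, hp, U, hU, rfl⟩ := hu
  have h1 := phiL_size T _ U hU
  have h2 := spl_size _ p hp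
  simp [sizeL_append]; omega

theorem connected_aux (T : List (LSub D)) (h : sizeL T = 0) : T = [] := by
  cases T with
  | nil => rfl
  | cons a l => cases a; simp [sizeL, sizeS] at h


/-- Assignments of the elements of a list to indices from `R`. -/
def asg {α : Type} : List α → List ℕ → Multiset (ℕ → List α)
  | [], _ => {fun _ => []}
  | a :: l, R => (R : Multiset ℕ).bind fun r => (asg l R).bind fun f =>
      {fun i => if r = i then a :: f i else f i}

theorem asg_nil_list {α : Type} (R : List ℕ) : asg ([] : List α) R = {fun _ => []} := rfl
theorem asg_cons {α β : Type} (a : α) (l : List α) (R : List ℕ) (F : (ℕ → List α) → Multiset β) :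
    (asg (a :: l) R).bind F = (R : Multiset ℕ).bind fun r => (asg l R).bind fun f =>
      F (fun i => if r = i then a :: f i else f i) := by
  simp [asg, bind_assoc, bind_map]

theorem asg_supp {α : Type} (T : List α) (R : List ℕ) :
    ∀ f ∈ asg T R, ∀ i, i ∉ R → f i = [] := by
  induction T with
  | nil => simp [asg]
  | cons a l ih =>
    intro f hf i hi
    simp only [asg, mem_bind, mem_singleton, mem_coe] at hf
    obtain ⟨r, hr, g, hg, rfl⟩ := hf
    have : r ≠ i := by rintro rfl; exact hi hr
    simp [this, ih g hg i hi]

theorem asg_append {α β : Type} (T : List α) (R S : List ℕ) (F : (ℕ → List α) → Multiset β)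
    (hd : ∀ i ∈ R, i ∉ S) :
    (asg T (R ++ S)).bind F = (spl T).bind fun p => (asg p.1 R).bind fun f =>
      (asg p.2 S).bind fun g => F (fun i => f i ++ g i) := by
  induction T generalizing F with
  | nil => simp [spl_nil, asg_nil_list]
  | cons a l ih =>
    simp only [asg_cons, spl_cons_bind]
    have h : ∀ r, ((asg l (R ++ S)).bind fun f => F fun i => if r = i then a :: f i else f i) = _ :=
      fun r => ih fun f => F fun i => if r = i then a :: f i else f i
    simp only [h, ← coe_add, add_bind]
    congr 1
    · rw [bind_bind]
      refine bcongr fun p => bcongr fun r => bcongr fun f => bcongr fun g => ?_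
      congr 1
      funext i
      split_ifs <;> rfl
    · rw [bind_bind]
      refine bcongr fun p => ?_
      rw [bind_bind]
      refine Multiset.bind_congr fun f hf => Multiset.bind_congr fun r hr => bcongr fun g => ?_
      congr 1
      funext i
      split_ifs with h
      · subst h
        rw [asg_supp _ _ f hf r (fun h => hd r h hr)]
        rfl
      · rfl

theorem asg_empty (T : List (LSub D)) {β : Type} (F : List (LSub D) → Multiset β)  :
    ((asg T []).bind fun _ => F []) = (phiL [] T).bind F := by
  cases T <;> simp [asg, phiL]

theorem asg_single {α : Type} (T : List α) (r : ℕ) :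
    asg T [r] = {fun i => if r = i then T else []} := by
  induction T with
  | nil => simp [asg]
  | cons a l ih =>
    simp only [asg, ih]
    simp
    funext i
    split_ifs <;> rfl

mutual
theorem graftS_congr (f g : ℕ → List (LSub D)) : ∀ (t : LSub D) (i : ℕ),
    (∀ j, i ≤ j → j < i + sizeS t → f j = g j) → graftS f i t = graftS g i t
  | .mk d cs, i, h => by
    simp only [graftS]
    rw [h i le_rfl (by simp [sizeS]), graftL_congr f g cs (i + 1)]
    intro j h1 h2
    exact h j (by omega) (by simp [sizeS]; omega)
theorem graftL_congr (f g : ℕ → List (LSub D)) : ∀ (t : List (LSub D)) (i : ℕ),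
    (∀ j, i ≤ j → j < i + sizeL t → f j = g j) → graftL f i t = graftL g i t
  | [], i, h => by simp [graftL]
  | t :: ts, i, h => by
    simp only [graftL]
    rw [graftS_congr f g t i, graftL_congr f g ts]
    · intro j h1 h2
      exact h j (by omega) (by simp [sizeL]; omega)
    · intro j h1 h2
      exact h j (by omega) (by simp [sizeL]; omega)
end

mutual
theorem asg_graftS : ∀ (t : LSub D) (x : List (LSub D)) (i : ℕ),
    ((asg x (List.range' i (sizeS t))).bind fun f => {graftS f i t}) = phiS t x
  | .mk d cs, x, i => by
    have e : List.range' i (sizeS (.mk d cs)) = [i] ++ List.range' (i + 1) (sizeL cs) := by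
      simp [sizeS, List.range'_succ, add_comm 1]
    rw [e, asg_append _ _ _ _ (by simp)]
    simp only [phiS, asg_single, singleton_bind]
    refine bcongr fun p => ?_
    rw [← asg_graftL cs p.2 (i + 1), bind_assoc]
    refine Multiset.bind_congr fun f hf => ?_
    have h0 : f i = [] := asg_supp _ _ f hf i (by simp)
    rw [singleton_bind, graftS]
    simp only [if_true, h0, List.append_nil]
    rw [graftL_congr _ f cs (i + 1)]
    intro j h1 h2
    rw [if_neg (by omega)]
    rfl
theorem asg_graftL : ∀ (t : List (LSub D)) (x : List (LSub D)) (i : ℕ),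
    ((asg x (List.range' i (sizeL t))).bind fun f => {graftL f i t}) = phiL t x
  | [], x, i => by
    simp only [sizeL, graftL]
    rw [List.range'_zero, asg_empty x fun V => {V}, bind_singleton]
    simp
  | t :: ts, x, i => by
    have e : List.range' i (sizeL (t :: ts)) =
        List.range' i (sizeS t) ++ List.range' (i + sizeS t) (sizeL ts) := by
      simp [sizeL, List.range'_append_1]
    rw [e, asg_append _ _ _ _ (by simp; omega)]
    simp only [phiL]
    refine bcongr fun p => ?_
    rw [← asg_graftS t p.1 i, bind_assoc]
    refine Multiset.bind_congr fun f hf => ?_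
    rw [singleton_bind, ← asg_graftL ts p.2 (i + sizeS t), bind_assoc]
    refine Multiset.bind_congr fun g hg => ?_
    rw [singleton_bind, graftL]
    rw [graftS_congr _ f t i, graftL_congr _ g ts]
    · intro j h1 h2
      rw [asg_supp _ _ f hf j (by simp; omega)]
      rfl
    · intro j h1 h2
      rw [asg_supp _ _ g hg j (by simp; omega)]
      simp
end

theorem asg_graft (t x : List (LSub D)) :
    ((asg x (List.range (1 + sizeL t))).bind fun f => {graft f t}) = mu x t := by
    have e : List.range (1 + sizeL t) = [0] ++ List.range' 1 (sizeL t) := by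
      simp [List.range_eq_range', List.range'_succ, add_comm 1]
    rw [e, asg_append _ _ _ _ (by simp)]
    simp only [mu, asg_single, singleton_bind]
    refine bcongr fun p => ?_
    rw [← asg_graftL t p.2 1, bind_assoc]
    refine Multiset.bind_congr fun f hf => ?_
    have h0 : f 0 = [] := asg_supp _ _ f hf 0 (by simp)
    rw [singleton_bind, graft]
    simp only [if_true, h0, List.append_nil]
    rw [graftL_congr _ f t 1]
    intro j h1 h2
    rw [if_neg (by omega)]
    rfl

theorem choices_asg {α : Type} (T : List α) (n : ℕ) :
    ((choices T.length n : List (List ℕ)) : Multiset (List ℕ)).map (fun c i => (T.zip c).filterMap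
      fun p => if p.2 = i then some p.1 else none) = asg T (List.range n) := by
  induction T with
  | nil => simp [choices, asg]
  | cons a l ih =>
    have e : (choices (a :: l).length n : Multiset (List ℕ)) = 
        ((List.range n : List ℕ) : Multiset ℕ).bind fun c =>
          (choices l.length n : Multiset (List ℕ)).map fun d => c :: d := by
      simp [choices]
    rw [e, asg, ← ih, map_bind]
    refine bcongr fun c => ?_
    rw [map_map, bind_map, bind_singleton]
    refine Multiset.map_congr rfl fun d _ => ?_
    funext i
    by_cases h : c = i <;> simp [h]

/-- The sum of basis vectors. -/
noncomputable def ms (k : Type) [Semiring k] (s : Multiset (LTree D)) : LTree D →₀ k :=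
  (s.map fun t => Finsupp.single t (1 : k)).sum

theorem mulT_eq (k : Type) [Semiring k] (x y : LTree D) : mulT k x y = ms k (mu x y) := by
  rw [mulT, ms, ← asg_graft, ← choices_asg, bind_map, bind_singleton, map_map]
  rfl


section linear
open TensorProduct
variable {k : Type} [Field k]

/-- basis vector -/
noncomputable def e (k : Type) [Field k] (T : LTree D) : LTree D →₀ k := Finsupp.single T (1 : k)

/-- sum over a multiset -/
def ss {α M : Type} [AddCommMonoid M] (s : Multiset α) (F : α → M) : M := (s.map F).sum

theorem ss_bind {α β M : Type} [AddCommMonoid M] (s : Multiset α) (t : α → Multiset β) (F : β → M) :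
    ss (s.bind t) F = ss s fun a => ss (t a) F := by
  simp [ss, map_bind, sum_bind]

theorem ss_singleton {α M : Type} [AddCommMonoid M] (a : α) (F : α → M) :
    ss {a} F = F a := by simp [ss]

theorem ss_congr {α M : Type} [AddCommMonoid M] {s : Multiset α} {F G : α → M}
    (h : ∀ a ∈ s, F a = G a) : ss s F = ss s G := by
  rw [ss, ss, Multiset.map_congr rfl h]

theorem map_ss {α M N H : Type} [AddCommMonoid M] [AddCommMonoid N] [FunLike H M N]
    [AddMonoidHomClass H M N] (f : H)
    (s : Multiset α) (F : α → M) : f (ss s F) = ss s fun a => f (F a) := by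
  simp [ss, map_multiset_sum, map_map]

theorem ss_add {α M : Type} [AddCommMonoid M] (s : Multiset α) (F G : α → M) :
    ss s (fun a => F a + G a) = ss s F + ss s G := by
  simp [ss]

theorem ss_zero {α M : Type} [AddCommMonoid M] (s : Multiset α) :
    ss s (fun _ => (0 : M)) = 0 := by
  simp [ss]

theorem fin_sum_get {α M : Type} [AddCommMonoid M] (l : List α) (F : α → M) :
    ∑ i : Fin l.length, F (l.get i) = ss (l : Multiset α) F := by
  simp [ss]

theorem ss_coassoc {α M : Type} [AddCommMonoid M] (x : List α) (F : List α → List α → List α → M) :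
    (ss (spl x) fun p => ss (spl p.1) fun q => F q.1 q.2 p.2) =
      ss (spl x) fun p => ss (spl p.2) fun q => F p.1 q.1 q.2 := by
  have := congrArg (fun s => ss s fun t => F t.1 t.2.1 t.2.2)
    (spl_coassoc x fun a b c => {(a, b, c)})
  simpa only [ss_bind, ss_singleton] using this

theorem ss_cocomm {α M : Type} [AddCommMonoid M] (x : List α) (F : List α → List α → M) :
    (ss (spl x) fun p => F p.1 p.2) = ss (spl x) fun p => F p.2 p.1 := by
  have := congrArg (fun s => ss s fun t => F t.1 t.2)
    (spl_cocomm x fun a b => {(a, b)})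
  simpa only [ss_bind, ss_singleton] using this

theorem ss_counit {α M : Type} [AddCommMonoid M] (x : List α) (F : List α → List α → M) :
    (ss (spl x) fun p => if p.2 = [] then F p.1 p.2 else 0) = F x [] := by
  induction x generalizing F with
  | nil => simp [ss, spl_nil]
  | cons a l ih =>
    have := ih fun u v => F (a :: u) v
    simp only [ss] at this ⊢
    rw [spl_cons]
    simp [map_map, this]

theorem ext_aux {M : Type} [AddCommMonoid M] [Module k M] (f g : (LTree D →₀ k) →ₗ[k] M)
    (h : ∀ T, f (e k T) = g (e k T)) (x) : f x = g x := by
  have : f = g := by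
    ext T
    simpa [e] using h T
  rw [this]

theorem ms_eq (s : Multiset (LTree D)) : ms k s = ss s (e k) := rfl

noncomputable def mulL (k D : Type) [Field k] :
    (LTree D →₀ k) →ₗ[k] (LTree D →₀ k) →ₗ[k] (LTree D →₀ k) :=
  Finsupp.linearCombination k fun T1 => Finsupp.linearCombination k fun T2 => mulT k T1 T2

noncomputable def comulL (k D : Type) [Field k] :
    (LTree D →₀ k) →ₗ[k] (LTree D →₀ k) ⊗[k] (LTree D →₀ k) :=
  Finsupp.linearCombination k fun T => ss (spl T) fun p => e k p.1 ⊗ₜ[k] e k p.2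

noncomputable def counitL (k D : Type) [Field k] : (LTree D →₀ k) →ₗ[k] k :=
  Finsupp.linearCombination k fun T => if T.isEmpty then (1 : k) else 0

theorem mulL_e' (a b : LTree D) : mulL k D (e k a) (e k b) = mulT k a b := by
  simp [mulL, e]

theorem mulL_e (a b : LTree D) : mulL k D (e k a) (e k b) = ss (mu a b) (e k) := by
  rw [mulL_e', mulT_eq, ms_eq]

theorem mulL_ss_left (s : Multiset (LTree D)) (y) :
    mulL k D (ss s (e k)) y = ss s fun a => mulL k D (e k a) y := by
  rw [map_ss]
  exact map_ss (LinearMap.applyₗ y) s _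

theorem comulL_e (T : LTree D) :
    comulL k D (e k T) = ss (spl T) fun p => e k p.1 ⊗ₜ[k] e k p.2 := by
  simp [comulL, e]

theorem counitL_e (T : LTree D) : counitL k D (e k T) = if T = [] then (1 : k) else 0 := by
  simp [counitL, e]

theorem mulL_assoc (x y z) : mulL k D (mulL k D x y) z = mulL k D x (mulL k D y z) := by
  refine ext_aux ((mulL k D).flip z ∘ₗ (mulL k D).flip y) ((mulL k D).flip (mulL k D y z)) ?_ x
  intro a
  refine ext_aux ((mulL k D).flip z ∘ₗ (mulL k D (e k a)))
    (mulL k D (e k a) ∘ₗ (mulL k D).flip z) ?_ y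
  intro b
  refine ext_aux (mulL k D (mulL k D (e k a) (e k b)))
    (mulL k D (e k a) ∘ₗ (mulL k D (e k b))) ?_ z
  intro c
  rw [LinearMap.comp_apply, mulL_e, mulL_ss_left, mulL_e, map_ss]
  simp only [mulL_e]
  rw [← ss_bind, ← ss_bind, mu_assoc]

theorem mulL_one_left (x) : mulL k D (e k []) x = x := by
  refine ext_aux (mulL k D (e k [])) LinearMap.id ?_ x
  intro a
  rw [mulL_e, mu_nil_left, ss_singleton]; rfl

theorem mulL_one_right (x) : mulL k D x (e k []) = x := by
  refine ext_aux ((mulL k D).flip (e k [])) LinearMap.id ?_ x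
  intro a
  rw [LinearMap.flip_apply, mulL_e, mu_nil_right, ss_singleton]; rfl

theorem comulL_coassoc (x) : (TensorProduct.assoc k _ _ _)
      ((LinearMap.rTensor _ (comulL k D)) (comulL k D x)) =
      (LinearMap.lTensor _ (comulL k D)) (comulL k D x) := by
  refine ext_aux ((TensorProduct.assoc k _ _ _).toLinearMap ∘ₗ (LinearMap.rTensor _ (comulL k D)) ∘ₗ
    comulL k D) ((LinearMap.lTensor _ (comulL k D)) ∘ₗ comulL k D) ?_ x
  intro T
  simp only [LinearMap.comp_apply, LinearEquiv.coe_coe, comulL_e, map_ss, LinearMap.rTensor_tmul,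
    LinearMap.lTensor_tmul]
  have h1 : ∀ (s : Multiset (LTree D × LTree D)) (y : LTree D →₀ k),
      (ss s fun p => e k p.1 ⊗ₜ[k] e k p.2) ⊗ₜ[k] y = ss s fun p => (e k p.1 ⊗ₜ[k] e k p.2) ⊗ₜ[k] y :=
    fun s y => map_ss ((TensorProduct.mk k _ _).flip y) s _
  have h2 : ∀ (s : Multiset (LTree D × LTree D)) (y : LTree D →₀ k),
      y ⊗ₜ[k] (ss s fun p => e k p.1 ⊗ₜ[k] e k p.2) = ss s fun p => y ⊗ₜ[k] (e k p.1 ⊗ₜ[k] e k p.2) :=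
    fun s y => map_ss (TensorProduct.mk k _ _ y) s _
  simp only [h1, h2, map_ss, TensorProduct.assoc_tmul]
  exact ss_coassoc T fun a b c => e k a ⊗ₜ[k] (e k b ⊗ₜ[k] e k c)

theorem counit_right' (x) :
    (TensorProduct.rid k _) ((LinearMap.lTensor _ (counitL k D)) (comulL k D x)) = x := by
  refine ext_aux ((TensorProduct.rid k _).toLinearMap ∘ₗ (LinearMap.lTensor _ (counitL k D)) ∘ₗ
    comulL k D) LinearMap.id ?_ x
  intro T
  simp only [LinearMap.comp_apply, LinearEquiv.coe_coe, comulL_e, map_ss, LinearMap.lTensor_tmul,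
    TensorProduct.rid_tmul, counitL_e, ite_smul, one_smul, zero_smul]
  exact ss_counit T fun a b => e k a

theorem counit_left' (x) :
    (TensorProduct.lid k _) ((LinearMap.rTensor _ (counitL k D)) (comulL k D x)) = x := by
  refine ext_aux ((TensorProduct.lid k _).toLinearMap ∘ₗ (LinearMap.rTensor _ (counitL k D)) ∘ₗ
    comulL k D) LinearMap.id ?_ x
  intro T
  simp only [LinearMap.comp_apply, LinearEquiv.coe_coe, comulL_e, map_ss, LinearMap.rTensor_tmul,
    TensorProduct.lid_tmul, counitL_e, ite_smul, one_smul, zero_smul]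
  rw [ss_cocomm T fun a b => if a = [] then e k b else 0]
  exact ss_counit T fun a b => e k a

theorem comulL_cocomm (x) : (TensorProduct.comm k _ _) (comulL k D x) = comulL k D x := by
  refine ext_aux ((TensorProduct.comm k _ _).toLinearMap ∘ₗ comulL k D) (comulL k D) ?_ x
  intro T
  simp only [LinearMap.comp_apply, LinearEquiv.coe_coe, comulL_e, map_ss, TensorProduct.comm_tmul]
  exact ss_cocomm T fun a b => e k b ⊗ₜ[k] e k a

theorem comulL_mul (x y : LTree D) : comulL k D (mulL k D (e k x) (e k y)) =
    ss (spl x) fun p => ss (spl y) fun q =>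
      mulL k D (e k p.1) (e k q.1) ⊗ₜ[k] mulL k D (e k p.2) (e k q.2) := by
  simp only [mulL_e, map_ss, comulL_e]
  have h1 : ∀ (s t : Multiset (LTree D)), ss s (e k) ⊗ₜ[k] ss t (e k) =
      ss s fun a => ss t fun b => e k a ⊗ₜ[k] e k b := by
    intro s t
    refine (map_ss ((TensorProduct.mk k _ _).flip (ss t (e k))) s _).trans ?_
    refine ss_congr fun a _ => ?_
    exact map_ss (TensorProduct.mk k _ _ (e k a)) t _
  simp only [h1]
  have := congrArg (fun s => ss s fun t => e k t.1 ⊗ₜ[k] e k t.2)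
    (mu_spl x y fun a b => {(a, b)})
  simpa only [ss_bind, ss_singleton] using this

theorem counitL_mul (x y) :
    counitL k D (mulL k D x y) = counitL k D x * counitL k D y := by
  refine ext_aux (counitL k D ∘ₗ (mulL k D).flip y)
    ((LinearMap.mul k k).flip (counitL k D y) ∘ₗ counitL k D) ?_ x
  intro a
  refine ext_aux (counitL k D ∘ₗ (mulL k D (e k a)))
    ((LinearMap.mul k k (counitL k D (e k a))) ∘ₗ counitL k D) ?_ y
  intro b
  simp only [LinearMap.comp_apply, LinearMap.mul_apply', mulL_e, map_ss, counitL_e]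
  by_cases ha : a = []
  · subst ha
    simp [mu_nil_left, ss_singleton]
  · rw [if_neg ha, zero_mul]
    refine Eq.trans ?_ (ss_zero (mu a b))
    refine ss_congr fun W hW => if_neg ?_
    rintro rfl
    have := mu_size _ _ _ hW
    exact ha (connected_aux a (by simp [sizeL] at this; omega))

theorem mulT_graded (x y T : LTree D) (h : mulT k x y T ≠ 0) : sizeL T = sizeL x + sizeL y := by
  apply mu_size
  by_contra hT
  apply h
  rw [mulT_eq, ms_eq]
  refine (map_ss (Finsupp.applyAddHom T) (mu x y) (e k)).trans ?_
  rw [← ss_zero (mu x y)]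
  refine ss_congr fun W hW => ?_
  have : W ≠ T := by rintro rfl; exact hT hW
  simp [e, this]

/-- antipode with fuel -/
noncomputable def antF (m : (LTree D →₀ k) →ₗ[k] (LTree D →₀ k) →ₗ[k] (LTree D →₀ k)) :
    ℕ → LTree D → (LTree D →₀ k)
  | 0, T => if T = [] then e k [] else 0
  | n + 1, T => (if T = [] then e k [] else 0) -
      ss (spl T) fun p => if p.2 = [] then 0 else m (antF m n p.1) (e k p.2)

theorem antF_succ (m : (LTree D →₀ k) →ₗ[k] (LTree D →₀ k) →ₗ[k] (LTree D →₀ k)) (n : ℕ)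
    (T : LTree D) (h : T.length ≤ n) : antF m (n + 1) T = antF m n T := by
  induction n generalizing T with
  | zero =>
    have : T = [] := List.length_eq_zero_iff.1 (by omega)
    subst this
    simp [antF, ss, spl_nil]
  | succ n ih =>
    rw [antF]
    conv_rhs => rw [antF]
    congr 1
    refine ss_congr fun p hp => ?_
    split_ifs with h0
    · rfl
    · rw [ih]
      have h1 := spl_length T p hp
      have h2 := List.length_pos_iff.2 h0
      omega

theorem antF_ge (m : (LTree D →₀ k) →ₗ[k] (LTree D →₀ k) →ₗ[k] (LTree D →₀ k)) (n : ℕ)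
    (T : LTree D) (h : T.length ≤ n) : antF m n T = antF m T.length T := by
  induction n, h using Nat.le_induction with
  | base => rfl
  | succ n hn ih => rw [antF_succ _ _ _ hn, ih]

theorem exists_left_inv (m : (LTree D →₀ k) →ₗ[k] (LTree D →₀ k) →ₗ[k] (LTree D →₀ k))
    (hm : ∀ x, m x (e k []) = x) : ∃ S : LTree D → (LTree D →₀ k), ∀ T,
      (ss (spl T) fun p => m (S p.1) (e k p.2)) = if T = [] then e k [] else 0 := by
  refine ⟨fun T => antF m T.length T, fun T => ?_⟩
  have h1 : antF m T.length T = (if T = [] then e k [] else 0) -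
      ss (spl T) fun p => if p.2 = [] then 0 else m (antF m p.1.length p.1) (e k p.2) := by
    rw [← antF_succ m _ T le_rfl, antF]
    congr 1
    refine ss_congr fun p hp => ?_
    have h1 := spl_length T p hp
    rw [antF_ge m T.length p.1 (by omega)]
  have h2 : (ss (spl T) fun p => m (antF m p.1.length p.1) (e k p.2)) =
      (ss (spl T) fun p => if p.2 = [] then m (antF m p.1.length p.1) (e k p.2) else 0) +
      ss (spl T) fun p => if p.2 = [] then 0 else m (antF m p.1.length p.1) (e k p.2) := by
    rw [← ss_add]
    refine ss_congr fun p hp => ?_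
    split_ifs <;> simp
  rw [h2, ss_counit T fun a b => m (antF m a.length a) (e k b), hm, h1]
  simp

theorem exists_antipode (k D : Type) [Field k] : ∃ S : LTree D → (LTree D →₀ k),
    (∀ T, (ss (spl T) fun p => mulL k D (S p.1) (e k p.2)) = if T = [] then e k [] else 0) ∧
    (∀ T, (ss (spl T) fun p => mulL k D (e k p.1) (S p.2)) = if T = [] then e k [] else 0) := by
  obtain ⟨S, hS⟩ := exists_left_inv (mulL k D) mulL_one_right
  obtain ⟨R, hR⟩ := exists_left_inv (mulL k D).flip mulL_one_left
  have hR' : ∀ T, (ss (spl T) fun p => mulL k D (e k p.1) (R p.2)) = if T = [] then e k [] else 0 := by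
    intro T
    rw [← hR T]
    exact ss_cocomm T fun a b => mulL k D (e k a) (R b)
  refine ⟨S, hS, ?_⟩
  have : S = R := by
    funext T
    have h := ss_coassoc T fun a b c => mulL k D (mulL k D (S a) (e k b)) (R c)
    have h1 : ∀ p : LTree D × LTree D,
        (ss (spl p.1) fun q => mulL k D (mulL k D (S q.1) (e k q.2)) (R p.2)) =
        if p.1 = [] then R p.2 else 0 := by
      intro p
      refine (map_ss ((mulL k D).flip (R p.2)) (spl p.1)
        fun q => mulL k D (S q.1) (e k q.2)).symm.trans ?_
      rw [hS]
      split_ifs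
      · exact mulL_one_left _
      · exact map_zero _
    have h2 : ∀ p : LTree D × LTree D,
        (ss (spl p.2) fun q => mulL k D (mulL k D (S p.1) (e k q.1)) (R q.2)) =
        if p.2 = [] then S p.1 else 0 := by
      intro p
      simp only [mulL_assoc]
      rw [← map_ss, hR']
      split_ifs
      · exact mulL_one_right _
      · exact map_zero _
    simp only [h1, h2] at h
    rw [ss_cocomm T fun a b => if a = [] then R b else 0, ss_counit T fun a b => R a,
      ss_counit T fun a b => S a] at h
    exact h.symm
  rw [this]
  exact hR'

end linear
end TreeAux

/-- **Proposition.** `kLT(𝔖)` with the tree-attachment product and the splitting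
coproduct is a cocommutative graded connected Hopf algebra. -/
theorem kLT_is_graded_connected_cocomm_hopf (k D : Type) [Field k] :
    Nonempty (TreeHopfStructure k D) := by
  obtain ⟨S, hS1, hS2⟩ := TreeAux.exists_antipode k D
  have hSe : ∀ T, Finsupp.linearCombination k S (TreeAux.e k T) = S T := by
    intro T; simp [TreeAux.e]
  exact ⟨{
    mul := TreeAux.mulL k D
    comul := TreeAux.comulL k D
    counit := TreeAux.counitL k D
    antipode := Finsupp.linearCombination k S
    mul_basis := TreeAux.mulL_e'
    comul_basis := fun T => (TreeAux.comulL_e T).trans (TreeAux.fin_sum_get (splits T)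
      fun p => TensorProduct.tmul k (TreeAux.e k p.1) (TreeAux.e k p.2)).symm
    counit_basis := fun T => by simp [TreeAux.counitL]
    mul_assoc' := TreeAux.mulL_assoc
    one_mul' := TreeAux.mulL_one_left
    mul_one' := TreeAux.mulL_one_right
    coassoc := TreeAux.comulL_coassoc
    counit_comul_left := TreeAux.counit_left'
    counit_comul_right := TreeAux.counit_right'
    comul_mul := fun T1 T2 => by
      refine (TreeAux.comulL_mul T1 T2).trans ?_
      refine (TreeAux.fin_sum_get (splits T1) _).symm.trans ?_
      refine Finset.sum_congr rfl fun i _ => ?_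
      exact (TreeAux.fin_sum_get (splits T2) _).symm
    counit_mul := TreeAux.counitL_mul
    counit_one := by simp [TreeAux.counitL]
    cocomm := TreeAux.comulL_cocomm
    antipode_left := fun x => by
      refine TreeAux.ext_aux (TensorProduct.lift (TreeAux.mulL k D) ∘ₗ
        LinearMap.rTensor _ (Finsupp.linearCombination k S) ∘ₗ TreeAux.comulL k D)
        ((TreeAux.counitL k D).smulRight (TreeAux.e k [])) ?_ x
      intro T
      simp only [LinearMap.comp_apply, TreeAux.comulL_e, TreeAux.map_ss, LinearMap.rTensor_tmul,
        TensorProduct.lift.tmul, hSe, hS1, LinearMap.smulRight_apply, TreeAux.counitL_e]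
      split_ifs <;> simp
    antipode_right := fun x => by
      refine TreeAux.ext_aux (TensorProduct.lift (TreeAux.mulL k D) ∘ₗ
        LinearMap.lTensor _ (Finsupp.linearCombination k S) ∘ₗ TreeAux.comulL k D)
        ((TreeAux.counitL k D).smulRight (TreeAux.e k [])) ?_ x
      intro T
      simp only [LinearMap.comp_apply, TreeAux.comulL_e, TreeAux.map_ss, LinearMap.lTensor_tmul,
        TensorProduct.lift.tmul, hSe, hS2, LinearMap.smulRight_apply, TreeAux.counitL_e]
      split_ifs <;> simp
    mul_graded := TreeAux.mulT_graded
    comul_graded := fun T p hp => TreeAux.spl_size T p hp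
    connected := TreeAux.connected_aux }⟩
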